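/- arXiv:2603.01393 — 5 statements merged into one kernel-verified Lean document; each statement's English description precedes it below -/
import Mathlib

section
/- Let n be a natural number, let G be a simple graph on Fin n, and let S : Fin n → Finset (Fin n) be a family of columns satisfying the reachability invariant: for all i j : Fin n, if j ∈ S i then i and j are joined by a walk in G (G.Reachable i j). Suppose i j k : Fin n are such that k ∈ S i and k ∈ S j, and let S' be obtained from S by replacing both the i-th and the j-th column with the union S i ∪ S j (leaving all other columns unchanged). Then S' also satisfies the reachability invariant: for all a b : Fin n, if b ∈ S' a then G.Reachable a b. -/
/-- If a connections table `S` satisfies the reachability invariant with respect to a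
graph `G`, and columns `i` and `j` share a common member `k`, then replacing both
columns `i` and `j` by `S i ∪ S j` preserves the reachability invariant. -/
theorem connections_table_merge_preserves_invariant
    (n : ℕ) (G : SimpleGraph (Fin n)) (S : Fin n → Finset (Fin n))
    (hinv : ∀ i j : Fin n, j ∈ S i → G.Reachable i j)
    (i j k : Fin n) (hki : k ∈ S i) (hkj : k ∈ S j)
    (S' : Fin n → Finset (Fin n))
    (hS'i : S' i = S i ∪ S j) (hS'j : S' j = S i ∪ S j)
    (hS'other : ∀ a : Fin n, a ≠ i → a ≠ j → S' a = S a) :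
    ∀ a b : Fin n, b ∈ S' a → G.Reachable a b := by
  have hij : G.Reachable i j := (hinv i k hki).trans (hinv j k hkj).symm
  intro a b hb
  by_cases hai : a = i
  · subst hai
    rw [hS'i, Finset.mem_union] at hb
    exact hb.elim (hinv a b) fun h => hij.trans (hinv j b h)
  by_cases haj : a = j
  · subst haj
    rw [hS'j, Finset.mem_union] at hb
    exact hb.elim (fun h => hij.symm.trans (hinv i b h)) (hinv a b)
  · rw [hS'other a hai haj] at hb
    exact hinv a b hb
end

section
/- Let n ≥ 1 and let G be a connected simple graph on Fin n. Let S₀ : Fin n → Finset (Fin n) be a family of columns such that i ∈ S₀ i for every i, and such that for every edge {i, j} of G, either i ∈ S₀ j or j ∈ S₀ i. Then there exists a sequence of at most n² merge operations, each of which is legal for the family to which it is applied, transforming S₀ into the family in which every column equals Finset.univ (i.e., every entry of the table is 'true'). -/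
/-- A merge operation on columns `p.1` and `p.2` of a connections table: both columns
are replaced by their union, all other columns are unchanged. -/
def mergeColumns {n : ℕ} (S : Fin n → Finset (Fin n)) (p : Fin n × Fin n) :
    Fin n → Finset (Fin n) :=
  fun a => if a = p.1 ∨ a = p.2 then S p.1 ∪ S p.2 else S a

theorem subset_mergeColumns {n : ℕ} (S : Fin n → Finset (Fin n)) (p : Fin n × Fin n)
    (a : Fin n) : S a ⊆ mergeColumns S p a := by
  unfold mergeColumns
  split_ifs with h
  · rcases h with rfl | rfl
    · exact Finset.subset_union_left
    · exact Finset.subset_union_right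
  · exact Finset.Subset.rfl

/-- Merging two distinct columns strictly increases the number of true entries. -/
theorem sum_card_lt_sum_card_mergeColumns {n : ℕ} (S : Fin n → Finset (Fin n))
    {i j : Fin n} (hij : S i ≠ S j) :
    ∑ a, (S a).card < ∑ a, (mergeColumns S (i, j) a).card := by
  have hle : ∀ a ∈ Finset.univ, (S a).card ≤ (mergeColumns S (i, j) a).card :=
    fun a _ => Finset.card_le_card (subset_mergeColumns S (i, j) a)
  refine lt_of_le_of_ne (Finset.sum_le_sum hle) fun heq => hij ?_
  have hcard := (Finset.sum_eq_sum_iff_of_le hle).1 heq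
  have hcol : ∀ a, S a = mergeColumns S (i, j) a := fun a =>
    Finset.eq_of_subset_of_card_le (subset_mergeColumns S (i, j) a)
      (hcard a (Finset.mem_univ a)).ge
  rw [hcol i, hcol j]
  simp [mergeColumns]

/-- A family in which no legal merge changes anything is the all-`univ` family. -/
theorem eq_univ_of_forall_inter_nonempty {n : ℕ} {G : SimpleGraph (Fin n)}
    (hG : G.Connected) {S : Fin n → Finset (Fin n)} (hrefl : ∀ i, i ∈ S i)
    (hedge : ∀ i j, G.Adj i j → i ∈ S j ∨ j ∈ S i)
    (hS : ∀ i j, (S i ∩ S j).Nonempty → S i = S j) : S = fun _ => Finset.univ := by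
  have hadj : ∀ i j, G.Adj i j → S i = S j := fun i j h =>
    hS i j <| (hedge i j h).elim (fun h => ⟨i, Finset.mem_inter.2 ⟨hrefl i, h⟩⟩)
      fun h => ⟨j, Finset.mem_inter.2 ⟨h, hrefl j⟩⟩
  have hwalk : ∀ i j, G.Walk i j → S i = S j := by
    intro i j w
    induction w with
    | nil => rfl
    | cons h _ ih => exact (hadj _ _ h).trans ih
  funext i
  refine Finset.eq_univ_of_forall fun j => ?_
  obtain ⟨w⟩ := hG.preconnected i j
  exact hwalk i j w ▸ hrefl j

theorem sum_card_le_sq {n : ℕ} (S : Fin n → Finset (Fin n)) :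
    ∑ a, (S a).card ≤ n ^ 2 := by
  calc ∑ a, (S a).card ≤ ∑ _a : Fin n, n :=
        Finset.sum_le_sum fun a _ => card_finset_fin_le (S a)
    _ = n ^ 2 := by simp [sq]

/-- The table can be completed with at most as many merges as it has false entries. -/
theorem exists_legal_merges_length_add_sum_card_le {n : ℕ} {G : SimpleGraph (Fin n)}
    (hG : G.Connected) (S : Fin n → Finset (Fin n)) (hrefl : ∀ i, i ∈ S i)
    (hedge : ∀ i j, G.Adj i j → i ∈ S j ∨ j ∈ S i) :
    ∃ ops : List (Fin n × Fin n),
      ops.length + ∑ a, (S a).card ≤ n ^ 2 ∧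
      (∀ t : ℕ, ∀ ht : t < ops.length,
        ((List.foldl mergeColumns S (ops.take t)) (ops.get ⟨t, ht⟩).1 ∩
          (List.foldl mergeColumns S (ops.take t)) (ops.get ⟨t, ht⟩).2).Nonempty) ∧
      List.foldl mergeColumns S ops = fun _ => Finset.univ := by
  by_cases hS : ∀ i j, (S i ∩ S j).Nonempty → S i = S j
  · exact ⟨[], by simpa using sum_card_le_sq S, fun t ht => absurd ht (Nat.not_lt_zero t),
      eq_univ_of_forall_inter_nonempty hG hrefl hedge hS⟩
  · push Not at hS
    obtain ⟨i, j, hne, hij⟩ := hS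
    have hlt := sum_card_lt_sum_card_mergeColumns S hij
    have hle := sum_card_le_sq (mergeColumns S (i, j))
    have hsub := subset_mergeColumns S (i, j)
    obtain ⟨ops, hlen, hlegal, hfinal⟩ :=
      exists_legal_merges_length_add_sum_card_le hG (mergeColumns S (i, j))
        (fun a => hsub a (hrefl a))
        fun a b h => (hedge a b h).imp (fun h => hsub b h) fun h => hsub a h
    refine ⟨(i, j) :: ops, by rw [List.length_cons]; omega, fun t ht => ?_, hfinal⟩
    cases t with
    | zero => exact hne
    | succ t => exact hlegal t (Nat.lt_of_succ_lt_succ ht)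
termination_by n ^ 2 - ∑ a, (S a).card
decreasing_by omega

/-- If `G` is connected, `i ∈ S₀ i` for all `i`, and for every edge `{i, j}` of `G`
either `i ∈ S₀ j` or `j ∈ S₀ i`, then there is a sequence of at most `n ^ 2` merge
operations, each legal (the two merged columns intersect) for the family it is applied
to, turning `S₀` into the all-`univ` family. -/
theorem connections_table_can_be_completed
    (n : ℕ) (hn : 1 ≤ n) (G : SimpleGraph (Fin n)) (hG : G.Connected)
    (S₀ : Fin n → Finset (Fin n))
    (hrefl : ∀ i : Fin n, i ∈ S₀ i)
    (hedge : ∀ i j : Fin n, G.Adj i j → i ∈ S₀ j ∨ j ∈ S₀ i) :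
    ∃ ops : List (Fin n × Fin n),
      ops.length ≤ n ^ 2 ∧
      (∀ t : ℕ, ∀ ht : t < ops.length,
        ((List.foldl mergeColumns S₀ (ops.take t)) (ops.get ⟨t, ht⟩).1 ∩
          (List.foldl mergeColumns S₀ (ops.take t)) (ops.get ⟨t, ht⟩).2).Nonempty) ∧
      List.foldl mergeColumns S₀ ops = fun _ => Finset.univ := by
  obtain ⟨ops, hlen, h⟩ := exists_legal_merges_length_add_sum_card_le hG S₀ hrefl hedge
  exact ⟨ops, (Nat.le_add_right _ _).trans hlen, h⟩
end

section
/- Let k be a positive natural number and let c : ZMod k be arbitrary (the prover's secret choice of pile). Then the pushforward of the uniform probability mass function on ZMod k × ZMod k under the map (x, y) ↦ (c + x, x + y) equals the uniform probability mass function on ZMod k × ZMod k. In particular, the joint distribution of the verifier's observations in the pile choosing protocol (the position of the operated pile after the first shuffle, and the final position of the marked pile after the second shuffle) is uniform and does not depend on c. -/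
theorem PMF.map_equiv_uniformOfFintype {α β : Type*} [Fintype α] [Nonempty α] [Fintype β]
    [Nonempty β] (e : α ≃ β) :
    (PMF.uniformOfFintype α).map e = PMF.uniformOfFintype β := by
  classical
  ext b
  rw [PMF.map_apply, tsum_eq_single (e.symm b)]
  · simp [Fintype.card_congr e]
  · intro a ha
    rw [if_neg]
    rintro rfl
    simp at ha

/-- The bijection `(x, y) ↦ (c + x, x + y)` of `G × G`. -/
def pileShiftEquiv {G : Type*} [AddGroup G] (c : G) : G × G ≃ G × G where
  toFun p := (c + p.1, p.1 + p.2)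
  invFun q := (-c + q.1, -(-c + q.1) + q.2)
  left_inv p := by simp
  right_inv q := by simp only [add_neg_cancel_left]

/-- Zero-knowledge of the pile choosing protocol: for any secret choice `c`, the
pushforward of the uniform distribution on `ZMod k × ZMod k` (the two independent
pile-shifting shuffles) under `(x, y) ↦ (c + x, x + y)` is uniform, hence
independent of `c`. -/
theorem pile_choosing_observation_uniform
    (k : ℕ) [NeZero k] (c : ZMod k) :
    (PMF.uniformOfFintype (ZMod k × ZMod k)).map
        (fun p : ZMod k × ZMod k => (c + p.1, p.1 + p.2)) =
      PMF.uniformOfFintype (ZMod k × ZMod k) := by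
  exact PMF.map_equiv_uniformOfFintype (pileShiftEquiv c)
end

section
/- Let k be a positive natural number, m a natural number, and let c, c' : Fin m → ZMod k satisfy c i − c j = c' i − c' j for all i, j : Fin m. Then the pushforward of the uniform probability mass function on ZMod k under the map x ↦ (fun i => c i + x) equals the pushforward of the uniform probability mass function on ZMod k under the map x ↦ (fun i => c' i + x). In particular, after a uniformly random circular shift, the distribution of the positions of m marked piles depends only on their pairwise relative positions, not on their absolute positions. -/
/-- Tuples with the same pairwise differences are translates of each other. -/
theorem exists_eq_add_of_sub_eq_sub {ι G : Type*} [AddCommGroup G] {c c' : ι → G}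
    (h : ∀ i j, c i - c j = c' i - c' j) : ∃ d, ∀ i, c i = c' i + d := by
  rcases isEmpty_or_nonempty ι with hι | ⟨⟨j⟩⟩
  · exact ⟨0, fun i => isEmptyElim i⟩
  · refine ⟨c j - c' j, fun i => ?_⟩
    rw [eq_add_of_sub_eq (h i j)]
    abel

/-- Zero-knowledge of the reversible pile-shifting shuffle: if two tuples of pile
positions `c` and `c'` have the same pairwise relative positions, then after a
uniformly random circular shift their position tuples have the same distribution. -/
theorem shifted_positions_depend_only_on_relative_positions
    (k : ℕ) [NeZero k] (m : ℕ) (c c' : Fin m → ZMod k)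
    (h : ∀ i j : Fin m, c i - c j = c' i - c' j) :
    (PMF.uniformOfFintype (ZMod k)).map (fun x => fun i => c i + x) =
      (PMF.uniformOfFintype (ZMod k)).map (fun x => fun i => c' i + x) := by
  obtain ⟨d, hd⟩ := exists_eq_add_of_sub_eq_sub h
  conv_rhs => rw [← PMF.map_equiv_uniformOfFintype (Equiv.addLeft d), PMF.map_comp]
  congr 1
  ext x i
  simp [hd, add_assoc]
end

section
/- Let α be a type with three pairwise distinct elements club, diamond, heart : α, let k ≥ 1, and let L = List.replicate (k−1) club ++ [diamond] ++ List.replicate k heart (a list of length 2k). Then for every natural number r, the length-k prefix (L.rotate r).take k contains diamond if and only if there exists l with 1 ≤ l ≤ k such that (L.rotate r).take k = List.replicate (l−1) club ++ [diamond] ++ List.replicate (k−l) heart. Moreover, for every l with 1 ≤ l ≤ k there exists a rotation amount r such that (L.rotate r).take k = List.replicate (l−1) club ++ [diamond] ++ List.replicate (k−l) heart. -/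
/-- Rotating by at most the number of leading `a`s moves that many of them to the end. -/
theorem take_rotate_replicate_of_le {α : Type*} (a b c : α) (m j : ℕ) :
    ((List.replicate (j + m) a ++ [b] ++ List.replicate (j + m + 1) c).rotate j).take
        (j + m + 1) =
      List.replicate m a ++ [b] ++ List.replicate j c := by
  have h := List.rotate_append_length_eq (List.replicate j a)
    (List.replicate m a ++ [b] ++ List.replicate j c ++ List.replicate (m + 1) c)
  rw [List.length_replicate] at h
  rw [Nat.add_assoc j m 1, List.replicate_add, List.replicate_add]
  simp only [List.append_assoc] at h ⊢
  rw [h]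
  simp only [← List.append_assoc]
  rw [List.append_assoc _ (List.replicate (m + 1) c)]
  exact List.take_left' (by simp; omega)

/-- Rotating past the single `b` leaves a prefix of `c`s and `a`s. -/
theorem notMem_take_rotate_replicate {α : Type*} {a b c : α} (hab : a ≠ b) (hbc : b ≠ c)
    (n i j : ℕ) (hj : 1 ≤ j) :
    b ∉ ((List.replicate n a ++ [b] ++ List.replicate (i + j) c).rotate (n + 1 + i)).take
        (n + 1) := by
  have h := List.rotate_append_length_eq (List.replicate n a ++ [b] ++ List.replicate i c)
    (List.replicate j c)
  have hlen : (List.replicate n a ++ [b] ++ List.replicate i c).length = n + 1 + i := by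
    simp; omega
  rw [hlen] at h
  rw [List.replicate_add, ← List.append_assoc, h, List.append_assoc, ← List.append_assoc,
    List.take_append_of_le_length (by simp; omega)]
  intro hmem
  have := List.mem_of_mem_take hmem
  simp [hab.symm, hbc] at this

/-- Soundness and completeness of the mask-sequence construction in the segment
embedding protocol. Starting from the list of `k-1` clubs, one diamond and `k` hearts,
after any rotation the length-`k` prefix contains the diamond iff it is exactly a mask
sequence `club^(l-1) ++ [diamond] ++ heart^(k-l)` for some `1 ≤ l ≤ k`; and every such
mask sequence is obtainable by some rotation. -/
theorem mask_sequence_construction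
    {α : Type*} (club diamond heart : α)
    (hcd : club ≠ diamond) (hch : club ≠ heart) (hdh : diamond ≠ heart)
    (k : ℕ) (hk : 1 ≤ k) :
    (∀ r : ℕ,
      diamond ∈
          ((List.replicate (k - 1) club ++ [diamond] ++ List.replicate k heart).rotate
              r).take k ↔
        ∃ l : ℕ, 1 ≤ l ∧ l ≤ k ∧
          ((List.replicate (k - 1) club ++ [diamond] ++ List.replicate k heart).rotate
              r).take k =
            List.replicate (l - 1) club ++ [diamond] ++ List.replicate (k - l) heart) ∧
    (∀ l : ℕ, 1 ≤ l → l ≤ k → ∃ r : ℕ,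
      ((List.replicate (k - 1) club ++ [diamond] ++ List.replicate k heart).rotate
          r).take k =
        List.replicate (l - 1) club ++ [diamond] ++ List.replicate (k - l) heart) := by
  have mask : ∀ l, 1 ≤ l → l ≤ k →
      ((List.replicate (k - 1) club ++ [diamond] ++ List.replicate k heart).rotate
          (k - l)).take k =
        List.replicate (l - 1) club ++ [diamond] ++ List.replicate (k - l) heart := by
    intro l hl hlk
    have h := take_rotate_replicate_of_le club diamond heart (l - 1) (k - l)
    rwa [show k - l + (l - 1) + 1 = k by omega, show k - l + (l - 1) = k - 1 by omega] at h
  refine ⟨fun r => ⟨fun hmem => ?_, ?_⟩, fun l hl hlk => ⟨k - l, mask l hl hlk⟩⟩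
  · have hlen : (List.replicate (k - 1) club ++ [diamond] ++
        List.replicate k heart).length = 2 * k := by
      simp; omega
    rw [← List.rotate_mod, hlen] at hmem ⊢
    have hs : r % (2 * k) < 2 * k := Nat.mod_lt _ (by omega)
    generalize r % (2 * k) = s at hmem hs ⊢
    by_cases hsk : s < k
    · refine ⟨k - s, by omega, by omega, ?_⟩
      have h := mask (k - s) (by omega) (by omega)
      rwa [show k - (k - s) = s by omega] at h ⊢
    · have h := notMem_take_rotate_replicate hcd hdh (k - 1) (s - k) (2 * k - s) (by omega)
      rw [show k - 1 + 1 + (s - k) = s by omega, show k - 1 + 1 = k by omega,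
        show s - k + (2 * k - s) = k by omega] at h
      exact absurd hmem h
  · rintro ⟨l, -, -, h⟩
    rw [h]
    simp
end
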